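/- Fix real parameters a > 0 and b > 0. Consider the vector field on ℝ⁴ (coordinates (x, r, ε, q)) given by x' = r·ε·q·(a + r), r' = −r·ε·(b·r + q·(x − 2b·r)), ε' = ε²·(b·r + q·(x − 2b·r)), q' = q·(b·r + q·(x − 2b·r)). If (x, r, ε, q) : J → ℝ⁴ is a solution on an interval J with ε(t) > 0 for all t ∈ J, and q(t₀) = exp(−1/ε(t₀)) for some t₀ ∈ J, then q(t) = exp(−1/ε(t)) for all t ∈ J; i.e. the set Q = {(x, r, ε, q) : ε > 0, q = exp(−ε⁻¹)} is invariant. -/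

import Mathlib

/-- A function with vanishing derivative within an order-connected set is constant on it. -/
theorem Set.OrdConnected.eq_of_hasDerivWithinAt_zero {J : Set ℝ} (hJ : J.OrdConnected) {g : ℝ → ℝ}
    (hg : ∀ t ∈ J, HasDerivWithinAt g 0 J t) {s t : ℝ} (hs : s ∈ J) (ht : t ∈ J) :
    g t = g s := by
  have h := hJ.convex.norm_image_sub_le_of_norm_hasDerivWithin_le (C := 0) hg (by simp) hs ht
  rw [zero_mul] at h
  exact sub_eq_zero.mp (norm_le_zero_iff.mp h)

/-- If `ε' = ε² F` and `q' = q F`, then `q exp(ε⁻¹)` is a first integral. -/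
theorem HasDerivWithinAt.mul_exp_inv_eq_zero {J : Set ℝ} {ε q : ℝ → ℝ} {F t : ℝ}
    (hε : HasDerivWithinAt ε ((ε t) ^ 2 * F) J t) (hq : HasDerivWithinAt q (q t * F) J t)
    (hε0 : ε t ≠ 0) :
    HasDerivWithinAt (fun s => q s * Real.exp (ε s)⁻¹) 0 J t := by
  refine (hq.mul (hε.fun_inv hε0).exp).congr_deriv ?_
  field_simp
  ring

/-- Invariance of the set `Q = {(x,r,ε,q) : ε > 0, q = exp(−ε⁻¹)}` for the extended
Le Corbeiller system with auxiliary exponential variable `q`: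
`x' = rεq(a + r)`, `r' = −rε(br + q(x − 2br))`, `ε' = ε²(br + q(x − 2br))`,
`q' = q(br + q(x − 2br))`. -/
theorem extended_corbeiller_Q_invariant (a b : ℝ) (ha : 0 < a) (hb : 0 < b)
    (J : Set ℝ) (hJ : J.OrdConnected)
    (x r ε q : ℝ → ℝ)
    (hx : ∀ t ∈ J, HasDerivWithinAt x (r t * ε t * q t * (a + r t)) J t)
    (hr : ∀ t ∈ J,
      HasDerivWithinAt r (-(r t) * ε t * (b * r t + q t * (x t - 2 * b * r t))) J t)
    (hε : ∀ t ∈ J,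
      HasDerivWithinAt ε ((ε t) ^ 2 * (b * r t + q t * (x t - 2 * b * r t))) J t)
    (hq : ∀ t ∈ J,
      HasDerivWithinAt q (q t * (b * r t + q t * (x t - 2 * b * r t))) J t)
    (hεpos : ∀ t ∈ J, 0 < ε t)
    (t₀ : ℝ) (ht₀ : t₀ ∈ J) (hq0 : q t₀ = Real.exp (-1 / ε t₀)) :
    ∀ t ∈ J, q t = Real.exp (-1 / ε t) := by
  intro t ht
  have h : q t * Real.exp (ε t)⁻¹ = q t₀ * Real.exp (ε t₀)⁻¹ :=
    hJ.eq_of_hasDerivWithinAt_zero (g := fun s => q s * Real.exp (ε s)⁻¹)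
      (fun s hs => (hε s hs).mul_exp_inv_eq_zero (hq s hs) (hεpos s hs).ne') ht₀ ht
  rw [hq0, neg_div, one_div, ← Real.exp_add, neg_add_cancel, Real.exp_zero] at h
  rw [neg_div, one_div, Real.exp_neg]
  exact eq_inv_of_mul_eq_one_left h
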